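/- (PRM decomposition of a trajectory into process steps.) For every index i ∈ {1,…,k}, the token spans {t ∈ ℕ : s(λ) ≤ t < e(λ)}, ranging over the process sets λ ∈ B(G) with i ∈ λ, are pairwise disjoint for distinct λ, and their union is exactly {0, 1, …, len(g_i) − 1}; i.e., the process steps of the process sets containing trajectory i partition the token positions of g_i. -/

import Mathlib

/-- `nodeG g p` is the set of indices `i` such that `p` is a prefix of the trajectory `g i`. -/
noncomputable def nodeG {α : Type*} {k : ℕ} (g : Fin k → List α) (p : List α) :
    Finset (Fin k) :=
  @Finset.filter _ (fun i => p <+: g i) (Classical.decPred _) Finset.univ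

/-- `BG g` is the family of process sets: nonempty sets of the form `nodeG g p`. -/
def BG {α : Type*} {k : ℕ} (g : Fin k → List α) : Set (Finset (Fin k)) :=
  {L | ∃ p : List α, (nodeG g p).Nonempty ∧ nodeG g p = L}

/-- `eG g L` is the length of the longest common prefix of the trajectories `g i`, `i ∈ L`. -/
noncomputable def eG {α : Type*} {k : ℕ} (g : Fin k → List α) (L : Finset (Fin k)) : ℕ :=
  sSup {n : ℕ | ∃ p : List α, p.length = n ∧ ∀ i ∈ L, p <+: g i}

-- The immediate parent of a process set: its least strict superset in `BG g`.
open Classical in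
noncomputable def parentG {α : Type*} {k : ℕ} (g : Fin k → List α) (L : Finset (Fin k)) :
    Finset (Fin k) :=
  if h : ∃ M, M ∈ BG g ∧ L ⊂ M ∧ ∀ M' ∈ BG g, L ⊂ M' → M ⊆ M' then h.choose
  else Finset.univ

/-- Start index of the process step of `L`: `0` for the root, `eG g (parentG g L)` otherwise. -/
noncomputable def sG {α : Type*} {k : ℕ} (g : Fin k → List α) (L : Finset (Fin k)) : ℕ :=
  if L = Finset.univ then 0 else eG g (parentG g L)

/-- `XtG g t` is the family of process sets whose token span contains the index `t`. -/
noncomputable def XtG {α : Type*} {k : ℕ} (g : Fin k → List α) (t : ℕ) :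
    Finset (Finset (Fin k)) :=
  @Finset.filter _ (fun L => L ∈ BG g ∧ sG g L ≤ t ∧ t < eG g L)
    (Classical.decPred _) Finset.univ

/-- Mean of the rewards. -/
noncomputable def rmeanG {k : ℕ} (r : Fin k → ℝ) : ℝ := (∑ i, r i) / k

/-- Standard deviation of the rewards. -/
noncomputable def rstdG {k : ℕ} (r : Fin k → ℝ) : ℝ :=
  Real.sqrt ((∑ i, (r i - rmeanG r) ^ 2) / k)

/-- Outcome-level advantage `a_i`. -/
noncomputable def advG {k : ℕ} (r : Fin k → ℝ) (i : Fin k) : ℝ :=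
  (r i - rmeanG r) / rstdG r

/-- Step-level reward `R̂(λ)`. -/
noncomputable def RhatG {k : ℕ} (r : Fin k → ℝ) (L : Finset (Fin k)) : ℝ :=
  (∑ i ∈ L, r i) / L.card

/-- Step-level advantage `Â(λ)`. -/
noncomputable def AhatG {k : ℕ} (r : Fin k → ℝ) (L : Finset (Fin k)) : ℝ :=
  (RhatG r L - rmeanG r) / rstdG r

theorem mem_nodeG {α : Type*} {k : ℕ} {g : Fin k → List α} {p : List α} {i : Fin k} :
    i ∈ nodeG g p ↔ p <+: g i := by
  simp [nodeG]

theorem nodeG_mem_BG {α : Type*} {k : ℕ} {g : Fin k → List α} {p : List α} {i : Fin k}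
    (h : p <+: g i) : nodeG g p ∈ BG g :=
  ⟨p, ⟨i, mem_nodeG.2 h⟩, rfl⟩

theorem nodeG_subset_nodeG {α : Type*} {k : ℕ} {g : Fin k → List α} {p q : List α}
    (h : p <+: q) : nodeG g q ⊆ nodeG g p :=
  fun _ hj => mem_nodeG.2 (h.trans (mem_nodeG.1 hj))

/-- Two process sets with a common element are nested. -/
theorem BG_subset_or_subset {α : Type*} {k : ℕ} {g : Fin k → List α} {L M : Finset (Fin k)}
    {i : Fin k} (hL : L ∈ BG g) (hM : M ∈ BG g) (hiL : i ∈ L) (hiM : i ∈ M) :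
    L ⊆ M ∨ M ⊆ L := by
  obtain ⟨p, -, rfl⟩ := hL
  obtain ⟨q, -, rfl⟩ := hM
  rcases List.prefix_or_prefix_of_prefix (mem_nodeG.1 hiL) (mem_nodeG.1 hiM) with h | h
  · exact Or.inr (nodeG_subset_nodeG h)
  · exact Or.inl (nodeG_subset_nodeG h)

theorem univ_mem_BG {α : Type*} {k : ℕ} (g : Fin k → List α) (i : Fin k) :
    Finset.univ ∈ BG g := by
  have h : nodeG g [] = Finset.univ := by
    ext j
    simp [mem_nodeG]
  exact h ▸ nodeG_mem_BG (g := g) (i := i) List.nil_prefix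

theorem bddAbove_length_common_prefix {α : Type*} {k : ℕ} (g : Fin k → List α)
    {L : Finset (Fin k)} {i : Fin k} (hi : i ∈ L) :
    BddAbove {n : ℕ | ∃ p : List α, p.length = n ∧ ∀ j ∈ L, p <+: g j} := by
  refine ⟨(g i).length, ?_⟩
  rintro n ⟨p, rfl, hp⟩
  exact (hp i hi).length_le

theorem exists_common_prefix_length_eq_eG {α : Type*} {k : ℕ} (g : Fin k → List α)
    {L : Finset (Fin k)} {i : Fin k} (hi : i ∈ L) :
    ∃ p : List α, p.length = eG g L ∧ ∀ j ∈ L, p <+: g j :=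
  Nat.sSup_mem (s := {n : ℕ | ∃ p : List α, p.length = n ∧ ∀ j ∈ L, p <+: g j})
    ⟨0, [], rfl, fun _ _ => List.nil_prefix⟩ (bddAbove_length_common_prefix g hi)

theorem length_le_eG {α : Type*} {k : ℕ} {g : Fin k → List α} {L : Finset (Fin k)}
    {i : Fin k} (hi : i ∈ L) {p : List α} (hp : ∀ j ∈ L, p <+: g j) : p.length ≤ eG g L :=
  le_csSup (bddAbove_length_common_prefix g hi) ⟨p, rfl, hp⟩

theorem eG_le_length {α : Type*} {k : ℕ} (g : Fin k → List α) {L : Finset (Fin k)}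
    {i : Fin k} (hi : i ∈ L) : eG g L ≤ (g i).length := by
  obtain ⟨p, hp, h⟩ := exists_common_prefix_length_eq_eG g hi
  exact hp ▸ (h i hi).length_le

theorem eG_le_eG_of_subset {α : Type*} {k : ℕ} (g : Fin k → List α) {L M : Finset (Fin k)}
    {i : Fin k} (hi : i ∈ L) (h : L ⊆ M) : eG g M ≤ eG g L := by
  obtain ⟨p, hp, hpM⟩ := exists_common_prefix_length_eq_eG g (h hi)
  exact hp ▸ length_le_eG hi fun j hj => hpM j (h hj)

/-- The parent of a nonempty proper process set is its least strict superset in `BG g`. -/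
theorem parentG_spec {α : Type*} {k : ℕ} (g : Fin k → List α) {L : Finset (Fin k)}
    {i : Fin k} (hi : i ∈ L) (hL : L ≠ Finset.univ) :
    parentG g L ∈ BG g ∧ L ⊂ parentG g L ∧ ∀ M ∈ BG g, L ⊂ M → parentG g L ⊆ M := by
  have h : ∃ M, M ∈ BG g ∧ L ⊂ M ∧ ∀ M' ∈ BG g, L ⊂ M' → M ⊆ M' := by
    obtain ⟨M, hM⟩ := (Set.toFinite {M | M ∈ BG g ∧ L ⊂ M}).exists_minimal
      ⟨Finset.univ, univ_mem_BG g i, Finset.ssubset_univ_iff.2 hL⟩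
    refine ⟨M, hM.prop.1, hM.prop.2, fun M' hM' hLM' => ?_⟩
    rcases BG_subset_or_subset hM.prop.1 hM' (hM.prop.2.1 hi) (hLM'.1 hi) with h | h
    · exact h
    · exact hM.le_of_le ⟨hM', hLM'⟩ h
  rw [parentG, dif_pos h]
  exact h.choose_spec

theorem eG_le_sG_of_ssubset {α : Type*} {k : ℕ} {g : Fin k → List α} {L M : Finset (Fin k)}
    {i : Fin k} (hi : i ∈ L) (hM : M ∈ BG g) (h : L ⊂ M) : eG g M ≤ sG g L := by
  have hL : L ≠ Finset.univ := Finset.ssubset_univ_iff.1 (h.trans_subset (Finset.subset_univ M))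
  obtain ⟨-, hLP, hP⟩ := parentG_spec g hi hL
  rw [sG, if_neg hL]
  exact eG_le_eG_of_subset g (hLP.1 hi) (hP M hM h)

/-- The process step of the node of a prefix of length `t + 1` starts no later than `t`. -/
theorem sG_nodeG_take_le {α : Type*} {k : ℕ} (g : Fin k → List α) (i : Fin k) (t : ℕ) :
    sG g (nodeG g ((g i).take (t + 1))) ≤ t := by
  have hi : i ∈ nodeG g ((g i).take (t + 1)) := mem_nodeG.2 (List.take_prefix _ _)
  unfold sG
  split_ifs with hL
  · exact Nat.zero_le t
  · obtain ⟨-, hLP, -⟩ := parentG_spec g hi hL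
    by_contra! hlt
    obtain ⟨p, hp, hpP⟩ := exists_common_prefix_length_eq_eG g (hLP.1 hi)
    refine hLP.2 fun j hj => mem_nodeG.2 ?_
    have hle : ((g i).take (t + 1)).length ≤ p.length := by
      rw [List.length_take]
      omega
    exact (List.prefix_of_prefix_length_le (List.take_prefix _ _)
      (hpP i (hLP.1 hi)) hle).trans (hpP j hj)

theorem disjoint_process_steps_of_ssubset {α : Type*} {k : ℕ} {g : Fin k → List α}
    {L M : Finset (Fin k)} {i : Fin k} (hi : i ∈ L) (hM : M ∈ BG g) (h : L ⊂ M) :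
    Disjoint (Set.Ico (sG g L) (eG g L)) (Set.Ico (sG g M) (eG g M)) :=
  Set.disjoint_left.2 fun _ htL htM =>
    absurd (htM.2.trans_le (eG_le_sG_of_ssubset hi hM h)) (not_lt.2 htL.1)

/-- **PRM decomposition of a trajectory into process steps.** For every index `i`, the token
spans `[s(λ), e(λ))` of the process sets `λ ∈ B(G)` containing `i` are pairwise disjoint
for distinct `λ` and their union is exactly `{0, …, len(gᵢ) − 1}`. -/
theorem trajectory_partition_into_process_steps {α : Type*} {k : ℕ} (hk : 1 ≤ k)
    (g : Fin k → List α) (i : Fin k) :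
    (∀ L ∈ BG g, ∀ M ∈ BG g, i ∈ L → i ∈ M → L ≠ M →
        Set.Ico (sG g L) (eG g L) ∩ Set.Ico (sG g M) (eG g M) = ∅) ∧
      (⋃ L ∈ {L : Finset (Fin k) | L ∈ BG g ∧ i ∈ L}, Set.Ico (sG g L) (eG g L)) =
        Set.Iio (g i).length := by
  constructor
  · intro L hL M hM hiL hiM hne
    rw [← Set.disjoint_iff_inter_eq_empty]
    rcases BG_subset_or_subset hL hM hiL hiM with h | h
    · exact disjoint_process_steps_of_ssubset hiL hM (h.ssubset_of_ne hne)
    · exact (disjoint_process_steps_of_ssubset hiM hL (h.ssubset_of_ne hne.symm)).symm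
  · ext t
    simp only [Set.mem_iUnion, Set.mem_ofPred_eq, Set.mem_Ico, Set.mem_Iio, exists_prop]
    constructor
    · rintro ⟨L, ⟨-, hi⟩, -, ht⟩
      exact ht.trans_le (eG_le_length g hi)
    · intro ht
      have hi : i ∈ nodeG g ((g i).take (t + 1)) := mem_nodeG.2 (List.take_prefix _ _)
      refine ⟨_, ⟨nodeG_mem_BG (List.take_prefix _ _), hi⟩, sG_nodeG_take_le g i t, ?_⟩
      have hle := length_le_eG (g := g) hi fun j hj => mem_nodeG.1 hj
      rw [List.length_take] at hle
      omega
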